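/- arXiv:1112.1236 — 2 statements merged into one kernel-verified Lean document; each statement's English description precedes it below -/
import Mathlib

section
/- Let D be an integral domain and * a stable star operation of finite character on D such that D is *-sharp. Then for each maximal *-ideal M of D, the localization D_M is a valuation domain whose value group is order-isomorphic to a complete subgroup of the additive reals. In particular, D is a Prüfer *-multiplication domain of *-dimension at most 1. -/
open scoped nonZeroDivisors

/-- A star operation on an integral domain `D` with quotient field `K`: a map
`I ↦ I*` on (nonzero) fractional ideals such that `D* = D`, `(aI)* = a·I*`,
`I ⊆ I*`, `I ⊆ J → I* ⊆ J*` and `(I*)* = I*`. (The value at `0` is irrelevant.) -/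
structure StarOperation (D K : Type*) [CommRing D] [IsDomain D] [Field K]
    [Algebra D K] [IsFractionRing D K] where
  star : FractionalIdeal D⁰ K → FractionalIdeal D⁰ K
  star_one : star 1 = 1
  star_smul : ∀ (a : K), a ≠ 0 → ∀ I : FractionalIdeal D⁰ K, I ≠ 0 →
    star (FractionalIdeal.spanSingleton D⁰ a * I) = FractionalIdeal.spanSingleton D⁰ a * star I
  le_star : ∀ I : FractionalIdeal D⁰ K, I ≠ 0 → I ≤ star I
  star_mono : ∀ I J : FractionalIdeal D⁰ K, I ≠ 0 → J ≠ 0 → I ≤ J → star I ≤ star J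
  star_star : ∀ I : FractionalIdeal D⁰ K, I ≠ 0 → star (star I) = star I

/-- A subgroup `G` of `(ℝ, +)` is complete if every nonempty subset of `G` which is
bounded above has a supremum in `G`. -/
def AddSubgroup.IsCompleteSubgroup (G : AddSubgroup ℝ) : Prop :=
  ∀ S : Set G, S.Nonempty → BddAbove S → ∃ g : G, IsLUB S g

/-- `R` is a valuation domain whose value group is order-isomorphic to a complete
subgroup of the additive reals. -/
def IsCompleteValuationDomain (R : Type*) [CommRing R] [IsDomain R] : Prop :=
  ∃ _ : ValuationRing R, ∃ G : AddSubgroup ℝ, G.IsCompleteSubgroup ∧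
    Nonempty ((ValuationRing.ValueGroup R (FractionRing R))ˣ ≃*o Multiplicative G)

section StarSharpDefs

variable {D K : Type*} [CommRing D] [IsDomain D] [Field K] [Algebra D K] [IsFractionRing D K]

/-- `D` is sharp with respect to the operation `star` ("`*`-sharp"): whenever
`I ⊇ A·B` for nonzero ideals `I, A, B` of `D`, there exist nonzero ideals `H, J`
with `I* = (HJ)*`, `H* ⊇ A` and `J* ⊇ B`. -/
def IsSharpOp (star : FractionalIdeal D⁰ K → FractionalIdeal D⁰ K) : Prop :=
  ∀ I A B : Ideal D, I ≠ 0 → A ≠ 0 → B ≠ 0 → A * B ≤ I →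
    ∃ H J : Ideal D, H ≠ 0 ∧ J ≠ 0 ∧
      star (I : FractionalIdeal D⁰ K) =
        star ((H : FractionalIdeal D⁰ K) * (J : FractionalIdeal D⁰ K)) ∧
      (A : FractionalIdeal D⁰ K) ≤ star (H : FractionalIdeal D⁰ K) ∧
      (B : FractionalIdeal D⁰ K) ≤ star (J : FractionalIdeal D⁰ K)

/-- `D` is `*`-sharp for the star operation `s`. -/
def StarOperation.IsSharp (s : StarOperation D K) : Prop :=
  IsSharpOp s.star

/-- A star operation is stable if it distributes over (finite) intersections of
nonzero fractional ideals. -/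
def StarOperation.IsStable (s : StarOperation D K) : Prop :=
  ∀ I J : FractionalIdeal D⁰ K, I ≠ 0 → J ≠ 0 → s.star (I ⊓ J) = s.star I ⊓ s.star J

/-- A star operation has finite character if `I*` is the union of `H*` over the
nonzero finitely generated subideals `H` of `I`. -/
def StarOperation.HasFiniteCharacter (s : StarOperation D K) : Prop :=
  ∀ I : FractionalIdeal D⁰ K, I ≠ 0 → ∀ x ∈ s.star I,
    ∃ H : FractionalIdeal D⁰ K, H ≠ 0 ∧ (H : Submodule D K).FG ∧ H ≤ I ∧ x ∈ s.star H

/-- `M` is a maximal `*`-ideal for the operation `star`: maximal among the proper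
nonzero integral `*`-ideals of `D`. -/
def IsMaxStarIdealOp (star : FractionalIdeal D⁰ K → FractionalIdeal D⁰ K) (M : Ideal D) : Prop :=
  M ≠ 0 ∧ M ≠ ⊤ ∧ star (M : FractionalIdeal D⁰ K) = (M : FractionalIdeal D⁰ K) ∧
    ∀ J : Ideal D, J ≠ ⊤ → star (J : FractionalIdeal D⁰ K) = (J : FractionalIdeal D⁰ K) →
      M ≤ J → J = M

end StarSharpDefs

section SharpRings

variable {R : Type*} [CommRing R] [IsDomain R]

/-- A commutative ring is sharp if whenever `A * B ≤ I` for nonzero ideals, there is a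
factorization `I = H * J` with `A ≤ H` and `B ≤ J`. -/
def IsSharpRing (R : Type*) [CommRing R] : Prop :=
  ∀ I A B : Ideal R, I ≠ ⊥ → A ≠ ⊥ → B ≠ ⊥ → A * B ≤ I →
    ∃ H J : Ideal R, I = H * J ∧ A ≤ H ∧ B ≤ J

/-- Every nonzero ideal has a greatest common divisor, and this greatest common divisor is
compatible with multiplication. -/
def HasIdealGCD (R : Type*) [CommRing R] : Prop :=
  ∀ A : Ideal R, A ≠ ⊥ → ∃ h : R, (∀ x ∈ A, h ∣ x) ∧
    ∀ r k : R, (∀ x ∈ A, k ∣ r * x) → k ∣ r * h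

/-- In a local domain, factors of a nonzero principal ideal are principal. -/
theorem Ideal.exists_eq_span_of_mul_eq_span [IsLocalRing R] {a : R} (ha : a ≠ 0)
    {H J : Ideal R} (h : H * J = Ideal.span {a}) :
    ∃ x ∈ H, ∃ y ∈ J, x * y = a ∧ H = Ideal.span {x} ∧ J = Ideal.span {y} := by
  have key : ∃ x ∈ H, ∃ y ∈ J, x * y = a := by
    by_contra! hne
    have hle : H * J ≤ IsLocalRing.maximalIdeal R * Ideal.span {a} := by
      rw [Ideal.mul_le]
      intro x hx y hy
      have hxy : x * y ∈ Ideal.span {a} := h ▸ Ideal.mul_mem_mul hx hy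
      obtain ⟨c, hc⟩ := Ideal.mem_span_singleton'.1 hxy
      rw [← hc]
      refine Ideal.mul_mem_mul ?_ (Ideal.mem_span_singleton_self a)
      rw [IsLocalRing.mem_maximalIdeal, mem_nonunits_iff]
      rintro ⟨u, rfl⟩
      refine hne (↑u⁻¹ * x) (H.mul_mem_left _ hx) y hy ?_
      rw [mul_assoc, ← hc, ← mul_assoc, Units.inv_mul, one_mul]
    have hmem : a ∈ IsLocalRing.maximalIdeal R * Ideal.span {a} :=
      hle (h ▸ Ideal.mem_span_singleton_self a)
    obtain ⟨c, hc, hca⟩ := Ideal.mem_mul_span_singleton.1 hmem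
    have : c = 1 := mul_right_cancel₀ ha (by rw [hca, one_mul])
    subst this
    exact (IsLocalRing.maximalIdeal.isMaximal R).ne_top ((Ideal.eq_top_iff_one _).2 hc)
  obtain ⟨x, hx, y, hy, rfl⟩ := key
  refine ⟨x, hx, y, hy, rfl, le_antisymm ?_ ?_, le_antisymm ?_ ?_⟩
  · intro z hz
    have hzy : z * y ∈ Ideal.span {x * y} := h ▸ Ideal.mul_mem_mul hz hy
    rw [Ideal.mem_span_singleton] at hzy ⊢
    exact (mul_dvd_mul_iff_right (right_ne_zero_of_mul ha)).1 hzy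
  · rwa [Ideal.span_singleton_le_iff_mem]
  · intro z hz
    have hzy : x * z ∈ Ideal.span {x * y} := h ▸ Ideal.mul_mem_mul hx hz
    rw [Ideal.mem_span_singleton] at hzy ⊢
    exact (mul_dvd_mul_iff_left (left_ne_zero_of_mul ha)).1 hzy
  · rwa [Ideal.span_singleton_le_iff_mem]

theorem IsSharpRing.hasIdealGCD [IsLocalRing R] (hR : IsSharpRing R) : HasIdealGCD R := by
  intro A hA
  obtain ⟨a, haA, ha⟩ := Submodule.exists_mem_ne_zero_of_ne_bot hA
  set B : Ideal R := (Ideal.span {a}).colon (A : Set R) with hB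
  have hmemB : ∀ b, b ∈ B ↔ ∀ x ∈ A, a ∣ b * x := by
    intro b
    simp [hB, Submodule.mem_colon, Ideal.mem_span_singleton]
  have haB : a ∈ B := (hmemB a).2 fun x _ => Dvd.intro x rfl
  have hAB : A * B ≤ Ideal.span {a} := by
    rw [Ideal.mul_le]
    intro x hx b hb
    rw [Ideal.mem_span_singleton, mul_comm]
    exact (hmemB b).1 hb x hx
  obtain ⟨H, J, hHJ, hAH, hBJ⟩ := hR (Ideal.span {a}) A B
    (by simpa using ha) hA ((Submodule.ne_bot_iff B).2 ⟨a, haB, ha⟩) hAB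
  obtain ⟨h, -, j, -, rfl, rfl, rfl⟩ := Ideal.exists_eq_span_of_mul_eq_span ha hHJ.symm
  refine ⟨h, fun x hx => Ideal.mem_span_singleton.1 (hAH hx), fun r k hk => ?_⟩
  obtain ⟨c, hc⟩ := hk _ haA
  by_cases hk0 : k = 0
  · have hr : r = 0 := by
      rw [hk0, zero_mul] at hc
      exact (mul_eq_zero.1 hc).resolve_right ha
    simp [hr]
  have hcB : c ∈ B := by
    rw [hmemB]
    intro x hx
    obtain ⟨y, hy⟩ := hk x hx
    refine ⟨y, mul_left_cancel₀ hk0 ?_⟩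
    linear_combination (-x) * hc + h * j * hy
  obtain ⟨t, rfl⟩ := Ideal.mem_span_singleton.1 (hBJ hcB)
  refine ⟨t, mul_right_cancel₀ (right_ne_zero_of_mul ha) ?_⟩
  linear_combination hc

/-- In a sharp local domain, of two elements `x`, `y` such that `x` can be cancelled against `y`
in divisibilities, one is a unit. -/
theorem IsSharpRing.isUnit_or_isUnit [IsLocalRing R] (hR : IsSharpRing R) {x y : R} (hx : x ≠ 0)
    (hxy : ∀ z, x ∣ y * z → x ∣ z) : IsUnit x ∨ IsUnit y := by
  by_contra! hu
  obtain ⟨hux, huy⟩ := hu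
  set A : Ideal R := Ideal.span {x, y} with hA
  set I : Ideal R := Ideal.span {x, y ^ 2} with hI
  have hxA : x ∈ A := Ideal.subset_span (by simp)
  have hyA : y ∈ A := Ideal.subset_span (by simp)
  have hxI : x ∈ I := Ideal.subset_span (by simp)
  have hyI : y ^ 2 ∈ I := Ideal.subset_span (by simp)
  have hAA : A * A ≤ I := by
    rw [Ideal.mul_le]
    intro r hr q hq
    obtain ⟨r₁, r₂, rfl⟩ := Ideal.mem_span_pair.1 hr
    obtain ⟨q₁, q₂, rfl⟩ := Ideal.mem_span_pair.1 hq
    exact Ideal.mem_span_pair.2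
      ⟨r₁ * q₁ * x + r₁ * q₂ * y + r₂ * q₁ * y, r₂ * q₂, by ring⟩
  have hA0 : A ≠ ⊥ := (Submodule.ne_bot_iff A).2 ⟨x, hxA, hx⟩
  obtain ⟨H, J, hHJ, hAH, hAJ⟩ :=
    hR I A A ((Submodule.ne_bot_iff I).2 ⟨x, hxI, hx⟩) hA0 hA0 hAA
  have hmem : ∀ j, y * j ∈ I → j ∈ A := by
    intro j hj
    obtain ⟨a, b, hab⟩ := Ideal.mem_span_pair.1 hj
    obtain ⟨c, hc⟩ := hxy (j - b * y) ⟨a, by linear_combination -hab⟩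
    exact Ideal.mem_span_pair.2 ⟨c, b, by linear_combination -hc⟩
  have hJA : J ≤ A := fun j hj => hmem j (hHJ ▸ Ideal.mul_mem_mul (hAH hyA) hj)
  have hHA : H ≤ A := fun j hj =>
    hmem j (mul_comm j y ▸ hHJ ▸ Ideal.mul_mem_mul hj (hAJ hyA))
  have hxAA : x ∈ A * A := Ideal.mul_mono hHA hJA (hHJ ▸ hxI)
  rw [hA, Ideal.span_pair_mul_span_pair] at hxAA
  have hform : ∃ a b c : R, x = a * x ^ 2 + b * (x * y) + c * y ^ 2 := by
    simp only [Ideal.mem_span_insert, Ideal.mem_span_singleton'] at hxAA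
    obtain ⟨a, z, ⟨b, w, ⟨c, v, ⟨d, rfl⟩, rfl⟩, rfl⟩, hz⟩ := hxAA
    exact ⟨a, b + c, d, hz.trans (by ring)⟩
  obtain ⟨a, b, c, h⟩ := hform
  have hmax : a * x + b * y ∈ IsLocalRing.maximalIdeal R :=
    add_mem (Ideal.mul_mem_left _ _ hux) (Ideal.mul_mem_left _ _ huy)
  obtain ⟨u, hu⟩ : IsUnit (1 - (a * x + b * y)) := by
    by_contra hn
    have h1 := add_mem (show 1 - (a * x + b * y) ∈ IsLocalRing.maximalIdeal R from hn) hmax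
    rw [sub_add_cancel] at h1
    exact (IsLocalRing.maximalIdeal.isMaximal R).ne_top ((Ideal.eq_top_iff_one _).2 h1)
  have hxu : x * u = c * y ^ 2 := by rw [hu]; linear_combination h
  obtain ⟨t, rfl⟩ := hxy c (hxy _ ⟨u, by linear_combination -hxu⟩)
  have : (u : R) = t * y ^ 2 := mul_left_cancel₀ hx (by linear_combination hxu)
  exact huy (isUnit_of_dvd_unit ⟨t * y, by rw [this]; ring⟩ u.isUnit)

theorem IsSharpRing.valuationRing [IsLocalRing R] (hR : IsSharpRing R) : ValuationRing R := by
  rw [ValuationRing.iff_dvd_total]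
  refine ⟨fun x y => ?_⟩
  by_cases hx : x = 0
  · exact Or.inr (hx ▸ dvd_zero y)
  have hxA : x ∈ Ideal.span {x, y} := Ideal.subset_span (by simp)
  have hyA : y ∈ Ideal.span {x, y} := Ideal.subset_span (by simp)
  obtain ⟨h, hdvd, hgcd⟩ :=
    hR.hasIdealGCD (Ideal.span {x, y}) ((Submodule.ne_bot_iff _).2 ⟨x, hxA, hx⟩)
  obtain ⟨x, rfl⟩ := hdvd x hxA
  obtain ⟨y, rfl⟩ := hdvd y hyA
  have hcop : ∀ z, x ∣ y * z → x ∣ z := by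
    rintro z ⟨w, hw⟩
    rw [← mul_dvd_mul_iff_left (left_ne_zero_of_mul hx), mul_comm h z]
    refine hgcd z (h * x) fun r hr => ?_
    obtain ⟨a, b, rfl⟩ := Ideal.mem_span_pair.1 hr
    exact ⟨a * z + b * w, by linear_combination b * h * hw⟩
  rcases hR.isUnit_or_isUnit (right_ne_zero_of_mul hx) hcop with hu | hu
  · exact Or.inl (mul_dvd_mul_left h hu.dvd)
  · exact Or.inr (mul_dvd_mul_left h hu.dvd)

theorem HasIdealGCD.exists_dvd_pow [ValuationRing R] (hR : HasIdealGCD R) {p q : R} (hp : p ≠ 0)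
    (hq : ¬ IsUnit q) : ∃ n : ℕ, p ∣ q ^ n := by
  by_contra! hne
  have hdvd : ∀ n : ℕ, ∃ c, p = q ^ n * c := fun n =>
    (ValuationRing.dvd_total p (q ^ n)).resolve_left (hne n)
  set S : Set R := {c | ∃ n : ℕ, p = q ^ n * c} with hS
  have hpS : p ∈ Ideal.span S := Ideal.subset_span ⟨0, by simp⟩
  obtain ⟨h, hdiv, hgcd⟩ := hR (Ideal.span S) ((Submodule.ne_bot_iff _).2 ⟨p, hpS, hp⟩)
  have hh : h ≠ 0 := ne_zero_of_dvd_ne_zero hp (hdiv p hpS)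
  have hle : Ideal.span S ≤ Ideal.span {q * h} := by
    rw [Ideal.span_le]
    rintro c ⟨n, hn⟩
    obtain ⟨d, hd⟩ := hdvd (n + 1)
    have hq0 : q ^ n ≠ 0 := left_ne_zero_of_mul (hn ▸ hp)
    have hcd : c = q * d := mul_left_cancel₀ hq0 (by rw [← hn, hd, pow_succ, mul_assoc])
    rw [SetLike.mem_coe, Ideal.mem_span_singleton, hcd]
    exact mul_dvd_mul_left q (hdiv d (Ideal.subset_span ⟨n + 1, hd⟩))
  obtain ⟨t, ht⟩ := hgcd 1 (q * h) fun x hx => by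
    rw [one_mul]; exact Ideal.mem_span_singleton.1 (hle hx)
  refine hq (IsUnit.of_mul_eq_one t (mul_left_cancel₀ hh ?_))
  linear_combination -ht

end SharpRings

section ValueGroups

/-- An archimedean linearly ordered group in which nonempty bounded above sets have suprema is
order-isomorphic to a complete subgroup of the reals. -/
theorem exists_isCompleteSubgroup_orderMonoidIso {G : Type*} [CommGroup G] [LinearOrder G]
    [IsOrderedMonoid G] [MulArchimedean G]
    (hG : ∀ S : Set G, S.Nonempty → BddAbove S → ∃ g, IsLUB S g) :
    ∃ H : AddSubgroup ℝ, H.IsCompleteSubgroup ∧ Nonempty (G ≃*o Multiplicative H) := by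
  obtain ⟨f, hf⟩ := Archimedean.exists_orderAddMonoidHom_real_injective (Additive G)
  have hle : ∀ a b, f a ≤ f b ↔ a ≤ b :=
    fun a b => (f.monotone'.strictMono_of_injective hf).le_iff_le
  set H : AddSubgroup ℝ := f.toAddMonoidHom.range with hH
  let e : G ≃*o Multiplicative H :=
    { AddEquiv.toMultiplicativeRight (AddMonoidHom.ofInjective (f := f.toAddMonoidHom) hf) with
      map_le_map_iff' := fun {a b} => hle (Additive.ofMul a) (Additive.ofMul b) }
  refine ⟨H, fun S hS hb => ?_, ⟨e⟩⟩
  let i : G ≃o H := e.toOrderIso.trans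
    { Multiplicative.toAdd with map_rel_iff' := Iff.rfl }
  obtain ⟨g, hg⟩ := hG (i.symm '' S) (hS.image _) ((OrderIso.bddAbove_image i.symm).2 hb)
  exact ⟨i g, by simpa using i.symm.isLUB_image.1 hg⟩

namespace ValuationRing

variable {R K : Type*} [CommRing R] [IsDomain R] [ValuationRing R] [Field K] [Algebra R K]
  [IsFractionRing R K]

theorem valuation_algebraMap_le_iff {a b : R} :
    valuation R K (algebraMap R K a) ≤ valuation R K (algebraMap R K b) ↔ b ∣ a := by
  have : valuation R K (algebraMap R K a) ≤ valuation R K (algebraMap R K b) ↔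
      ∃ c : R, c • algebraMap R K b = algebraMap R K a := Iff.rfl
  rw [this]
  constructor
  · rintro ⟨c, hc⟩
    refine ⟨c, IsFractionRing.injective R K ?_⟩
    rw [← hc, Algebra.smul_def, map_mul, mul_comm]
  · rintro ⟨c, rfl⟩
    exact ⟨c, by rw [Algebra.smul_def, map_mul, mul_comm]⟩

theorem exists_valuation_algebraMap_eq {γ : ValueGroup R K} (hγ : γ ≤ 1) :
    ∃ a : R, valuation R K (algebraMap R K a) = γ := by
  obtain ⟨x, rfl⟩ : ∃ x : K, valuation R K x = γ := Quotient.exists_rep γ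
  obtain ⟨a, rfl⟩ := (mem_integer_iff R K x).1 hγ
  exact ⟨a, rfl⟩

theorem valuation_algebraMap_le_one (a : R) : valuation R K (algebraMap R K a) ≤ 1 :=
  (mem_integer_iff R K _).2 ⟨a, rfl⟩

theorem valuation_algebraMap_ne_zero {a : R} (ha : a ≠ 0) :
    valuation R K (algebraMap R K a) ≠ 0 := by
  rw [Ne, Valuation.zero_iff]
  simpa using ha

theorem exists_isLUB_of_hasIdealGCD (hR : HasIdealGCD R) (S : Set (ValueGroup R K)ˣ)
    (hS : S.Nonempty) (hb : BddAbove S) : ∃ g, IsLUB S g := by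
  obtain ⟨β, hβ⟩ := hb
  have hS1 : ∀ γ ∈ S, ((γ * β⁻¹ : (ValueGroup R K)ˣ) : ValueGroup R K) ≤ 1 := by
    intro γ hγ
    have : γ * β⁻¹ ≤ 1 := by simpa using hβ hγ
    exact_mod_cast this
  set T : Set R := {r | ∃ γ ∈ S,
    valuation R K (algebraMap R K r) = ((γ * β⁻¹ : (ValueGroup R K)ˣ) : ValueGroup R K)} with hT
  obtain ⟨γ₀, hγ₀⟩ := hS
  obtain ⟨r₀, hr₀⟩ := exists_valuation_algebraMap_eq (hS1 γ₀ hγ₀)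
  have hr₀' : r₀ ≠ 0 := by
    rintro rfl
    rw [map_zero, map_zero] at hr₀
    exact Units.ne_zero _ hr₀.symm
  have hr₀T : r₀ ∈ Ideal.span T := Ideal.subset_span ⟨γ₀, hγ₀, hr₀⟩
  obtain ⟨h, hdvd, hgcd⟩ := hR (Ideal.span T) ((Submodule.ne_bot_iff _).2 ⟨r₀, hr₀T, hr₀'⟩)
  have hh : h ≠ 0 := ne_zero_of_dvd_ne_zero hr₀' (hdvd r₀ hr₀T)
  set η : (ValueGroup R K)ˣ := Units.mk0 _ (valuation_algebraMap_ne_zero (K := K) hh) with hη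
  refine ⟨η * β, fun γ hγ => ?_, fun δ hδ => ?_⟩
  · obtain ⟨r, hr⟩ := exists_valuation_algebraMap_eq (hS1 γ hγ)
    have hle := (valuation_algebraMap_le_iff (K := K)).2
      (hdvd r (Ideal.subset_span ⟨γ, hγ, hr⟩))
    rw [hr] at hle
    have : γ * β⁻¹ ≤ η := hle
    rwa [mul_inv_le_iff_le_mul] at this
  · have hη1 : η ≤ 1 := valuation_algebraMap_le_one (K := K) h
    rcases le_total β δ with hβδ | hδβ
    · exact (mul_le_of_le_one_left' hη1).trans hβδ
    · have hδ1 : ((δ * β⁻¹ : (ValueGroup R K)ˣ) : ValueGroup R K) ≤ 1 := by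
        have : δ * β⁻¹ ≤ 1 := by simpa using hδβ
        exact_mod_cast this
      obtain ⟨k, hk⟩ := exists_valuation_algebraMap_eq hδ1
      have hle : Ideal.span T ≤ Ideal.span {k} := by
        rw [Ideal.span_le]
        rintro r ⟨γ, hγ, hr⟩
        rw [SetLike.mem_coe, Ideal.mem_span_singleton, ← valuation_algebraMap_le_iff (K := K),
          hr, hk]
        have : γ * β⁻¹ ≤ δ * β⁻¹ := mul_le_mul_left (hδ hγ) _
        exact_mod_cast this
      have hkh := hgcd 1 k fun x hx => by
        rw [one_mul]; exact Ideal.mem_span_singleton.1 (hle hx)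
      rw [one_mul, ← valuation_algebraMap_le_iff (K := K), hk] at hkh
      have : η ≤ δ * β⁻¹ := hkh
      rwa [le_mul_inv_iff_mul_le] at this

theorem mulArchimedean_units_of_hasIdealGCD (hR : HasIdealGCD R) :
    MulArchimedean (ValueGroup R K)ˣ := by
  refine ⟨fun x y hy => ?_⟩
  rcases le_total x 1 with hx | hx
  · exact ⟨0, by simpa using hx⟩
  have hx' : ((x⁻¹ : (ValueGroup R K)ˣ) : ValueGroup R K) ≤ 1 := by
    have : x⁻¹ ≤ 1 := by simpa using hx
    exact_mod_cast this
  have hy' : ((y⁻¹ : (ValueGroup R K)ˣ) : ValueGroup R K) ≤ 1 := by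
    have : y⁻¹ ≤ 1 := by simpa using hy.le
    exact_mod_cast this
  obtain ⟨p, hp⟩ := exists_valuation_algebraMap_eq hx'
  obtain ⟨q, hq⟩ := exists_valuation_algebraMap_eq hy'
  have hp0 : p ≠ 0 := by
    rintro rfl
    rw [map_zero, map_zero] at hp
    exact Units.ne_zero _ hp.symm
  have hqu : ¬ IsUnit q := by
    intro hu
    have h1 := (valuation_algebraMap_le_iff (K := K) (a := 1)).2 hu.dvd
    rw [map_one, map_one, hq] at h1
    have : 1 ≤ y⁻¹ := by exact_mod_cast h1
    exact absurd hy (by simpa using this)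
  obtain ⟨n, hn⟩ := hR.exists_dvd_pow hp0 hqu
  refine ⟨n, ?_⟩
  rw [← valuation_algebraMap_le_iff (K := K), map_pow, map_pow, hp, hq] at hn
  have : y⁻¹ ^ n ≤ x⁻¹ := by exact_mod_cast hn
  simpa using this

end ValuationRing

theorem IsSharpRing.isCompleteValuationDomain {R : Type*} [CommRing R] [IsDomain R]
    [IsLocalRing R] (hR : IsSharpRing R) : IsCompleteValuationDomain R := by
  have hV := hR.valuationRing
  have := ValuationRing.mulArchimedean_units_of_hasIdealGCD (K := FractionRing R) hR.hasIdealGCD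
  exact ⟨hV, exists_isCompleteSubgroup_orderMonoidIso
    (ValuationRing.exists_isLUB_of_hasIdealGCD hR.hasIdealGCD)⟩

end ValueGroups

open FractionalIdeal in
theorem FractionalIdeal.spanSingleton_mul_ne_zero {D K : Type*} [CommRing D] [Field K]
    [Algebra D K] [IsFractionRing D K] {a : K} (ha : a ≠ 0) {I : FractionalIdeal D⁰ K}
    (hI : I ≠ 0) : spanSingleton D⁰ a * I ≠ 0 := by
  intro h
  apply hI
  rw [← one_mul I, ← spanSingleton_one, ← inv_mul_cancel₀ ha,
    ← spanSingleton_mul_spanSingleton, mul_assoc, h, mul_zero]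

section StarOperations

open FractionalIdeal

variable {D K : Type*} [CommRing D] [IsDomain D] [Field K] [Algebra D K] [IsFractionRing D K]
  {s : StarOperation D K}

namespace StarOperation

theorem star_le_one (s : StarOperation D K) {I : FractionalIdeal D⁰ K} (hI : I ≠ 0)
    (h : I ≤ 1) : s.star I ≤ 1 :=
  s.star_one ▸ s.star_mono I 1 hI one_ne_zero h

theorem IsStable.exists_notMem_mul_mem (hst : s.IsStable) {M : Ideal D}
    (hM : IsMaxStarIdealOp s.star M) {I : Ideal D} (hI : I ≠ ⊥) {x : D}
    (hx : algebraMap D K x ∈ s.star (I : FractionalIdeal D⁰ K)) : ∃ t, t ∉ M ∧ t * x ∈ I := by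
  obtain ⟨hM0, hM1, hMs, -⟩ := hM
  by_cases hx0 : x = 0
  · exact ⟨1, fun h => hM1 ((Ideal.eq_top_iff_one M).2 h), by simp [hx0]⟩
  have hxK : algebraMap D K x ≠ 0 := by simpa using hx0
  by_contra! hne
  have hI' : (I : FractionalIdeal D⁰ K) ≠ 0 := coeIdeal_ne_zero.2 hI
  obtain ⟨a, haI, ha⟩ := Submodule.exists_mem_ne_zero_of_ne_bot hI
  set N := spanSingleton D⁰ (algebraMap D K x)⁻¹ * (I : FractionalIdeal D⁰ K) with hN
  have hN0 : N ≠ 0 := spanSingleton_mul_ne_zero (inv_ne_zero hxK) hI'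
  have hmem : ∀ y : K, y ∈ N ↔ ∃ b ∈ I, algebraMap D K x * y = algebraMap D K b := by
    intro y
    rw [hN, mem_singleton_mul]
    constructor
    · rintro ⟨_, hz, rfl⟩
      obtain ⟨b, hb, rfl⟩ := (mem_coeIdeal _).1 hz
      exact ⟨b, hb, by field_simp⟩
    · rintro ⟨b, hb, h⟩
      exact ⟨_, mem_coeIdeal_of_mem _ hb, by rw [← h]; field_simp⟩
  have haN : algebraMap D K a ∈ N ⊓ 1 := by
    refine ⟨(hmem _).2 ⟨x * a, I.mul_mem_left _ haI, (map_mul _ _ _).symm⟩, ?_⟩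
    exact (mem_one_iff _).2 ⟨a, rfl⟩
  have hN1 : N ⊓ 1 ≠ 0 := by
    intro h
    rw [h, mem_zero_iff] at haN
    exact ha (by simpa using haN)
  have hone : (1 : K) ∈ s.star (N ⊓ 1) := by
    rw [hst N 1 hN0 one_ne_zero, s.star_one, hN, s.star_smul _ (inv_ne_zero hxK) _ hI']
    exact ⟨mem_singleton_mul.2 ⟨_, hx, by field_simp⟩, one_mem_one _⟩
  have hle : N ⊓ 1 ≤ (M : FractionalIdeal D⁰ K) := by
    rintro y ⟨hy, hy1⟩
    obtain ⟨t, rfl⟩ := (mem_one_iff _).1 hy1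
    obtain ⟨b, hb, hbt⟩ := (hmem _).1 hy
    refine mem_coeIdeal_of_mem _ (by_contra fun ht => hne t ht ?_)
    rw [← map_mul] at hbt
    rwa [mul_comm, IsFractionRing.injective D K hbt]
  have h1M := s.star_mono _ _ hN1 (coeIdeal_ne_zero.2 hM0) hle hone
  rw [hMs] at h1M
  obtain ⟨m, hm, hm1⟩ := (mem_coeIdeal _).1 h1M
  have : m = 1 := IsFractionRing.injective D K (by rw [hm1, map_one])
  exact hM1 ((Ideal.eq_top_iff_one M).2 (this ▸ hm))

theorem isPrime_of_isMaxStarIdealOp {M : Ideal D} (hM : IsMaxStarIdealOp s.star M) :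
    M.IsPrime := by
  obtain ⟨hM0, hM1, hMs, hmax⟩ := hM
  refine ⟨hM1, fun {a b} hab => or_iff_not_imp_left.2 fun ha => ?_⟩
  by_cases hb : b = 0
  · exact hb ▸ M.zero_mem
  have hbK : algebraMap D K b ≠ 0 := by simpa using hb
  set N := M ⊔ Ideal.span {a} with hN
  have hMN : M ≤ N := le_sup_left
  have hN0 : N ≠ ⊥ := fun h => hM0 (le_bot_iff.1 (h ▸ hMN))
  have hN0' : (N : FractionalIdeal D⁰ K) ≠ 0 := coeIdeal_ne_zero.2 hN0
  obtain ⟨J, hJ⟩ := le_one_iff_exists_coeIdeal.1 (s.star_le_one hN0' coeIdeal_le_one)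
  have hNJ : N ≤ J := by
    rw [← coeIdeal_le_coeIdeal K, hJ]
    exact s.le_star _ hN0'
  have hJtop : J = ⊤ := by
    by_contra hJt
    have := hmax J hJt (by rw [hJ, s.star_star _ hN0']) (hMN.trans hNJ)
    exact ha (this ▸ hNJ (Ideal.mem_sup_right (Ideal.mem_span_singleton_self a)))
  have hle : spanSingleton D⁰ (algebraMap D K b) * (N : FractionalIdeal D⁰ K) ≤ M := by
    rw [← coeIdeal_span_singleton, ← coeIdeal_mul, coeIdeal_le_coeIdeal, hN, Ideal.mul_sup]
    refine sup_le Ideal.mul_le_right ?_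
    rw [Ideal.span_singleton_mul_span_singleton, Ideal.span_singleton_le_iff_mem, mul_comm]
    exact hab
  have h := s.star_mono _ _ (spanSingleton_mul_ne_zero hbK hN0')
    (coeIdeal_ne_zero.2 hM0) hle
  rw [hMs, s.star_smul _ hbK _ hN0', ← hJ, hJtop, coeIdeal_top, mul_one] at h
  obtain ⟨m, hm, hmb⟩ := (mem_coeIdeal _).1 (h (mem_spanSingleton_self _ _))
  exact IsFractionRing.injective D K hmb ▸ hm

theorem IsStable.map_le_map (hst : s.IsStable) {M : Ideal D} [M.IsPrime]
    (hM : IsMaxStarIdealOp s.star M) {I J : Ideal D} (hJ : J ≠ ⊥)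
    (h : (I : FractionalIdeal D⁰ K) ≤ s.star (J : FractionalIdeal D⁰ K)) :
    I.map (algebraMap D (Localization.AtPrime M)) ≤
      J.map (algebraMap D (Localization.AtPrime M)) := by
  rw [Ideal.map_le_iff_le_comap]
  intro x hx
  obtain ⟨t, htM, ht⟩ := hst.exists_notMem_mul_mem hM hJ (h (mem_coeIdeal_of_mem _ hx))
  rw [Ideal.mem_comap, ← Ideal.unit_mul_mem_iff_mem _
    (IsLocalization.map_units (Localization.AtPrime M) (⟨t, htM⟩ : M.primeCompl)), ← map_mul]
  exact Ideal.mem_map_of_mem _ ht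

theorem IsSharp.isSharpRing_localization (hsharp : s.IsSharp) (hst : s.IsStable) {M : Ideal D}
    [M.IsPrime] (hM : IsMaxStarIdealOp s.star M) : IsSharpRing (Localization.AtPrime M) := by
  intro I A B hI hA hB hAB
  have hmc : ∀ L : Ideal (Localization.AtPrime M),
      (L.comap (algebraMap D _)).map (algebraMap D (Localization.AtPrime M)) = L :=
    IsLocalization.map_under M.primeCompl _
  have hne : ∀ L : Ideal (Localization.AtPrime M), L ≠ ⊥ → L.comap (algebraMap D _) ≠ ⊥ := by
    intro L hL h
    apply hL
    rw [← hmc L, h, Ideal.map_bot]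
  obtain ⟨H, J, hH, hJ, hHJ, hAH, hBJ⟩ := hsharp _ _ _ (hne I hI) (hne A hA) (hne B hB)
    ((Ideal.le_comap_mul _).trans (Ideal.comap_mono hAB))
  rw [← coeIdeal_mul] at hHJ
  have hHJ0 : H * J ≠ ⊥ := mul_ne_zero hH hJ
  refine ⟨H.map (algebraMap D _), J.map (algebraMap D _), ?_, ?_, ?_⟩
  · rw [← Ideal.map_mul]
    refine le_antisymm ?_ ?_
    · have := hst.map_le_map hM hHJ0 (hHJ ▸ s.le_star _ (coeIdeal_ne_zero.2 (hne I hI)))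
      rwa [hmc] at this
    · have := hst.map_le_map hM (hne I hI) (hHJ ▸ s.le_star _ (coeIdeal_ne_zero.2 hHJ0))
      rwa [hmc] at this
  · have := hst.map_le_map hM hH hAH
    rwa [hmc] at this
  · have := hst.map_le_map hM hJ hBJ
    rwa [hmc] at this

theorem HasFiniteCharacter.exists_fg (hfc : s.HasFiniteCharacter) {I : Ideal D} (hI : I ≠ ⊥)
    {x : K} (hx : x ∈ s.star (I : FractionalIdeal D⁰ K)) :
    ∃ H : Ideal D, H ≠ ⊥ ∧ H.FG ∧ H ≤ I ∧ x ∈ s.star (H : FractionalIdeal D⁰ K) := by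
  obtain ⟨H, hH0, hHfg, hHI, hxH⟩ := hfc _ (coeIdeal_ne_zero.2 hI) x hx
  obtain ⟨H, rfl⟩ := le_one_iff_exists_coeIdeal.1 (hHI.trans coeIdeal_le_one)
  refine ⟨H, coeIdeal_ne_zero.1 hH0, ?_, (coeIdeal_le_coeIdeal K).1 hHI, hxH⟩
  exact (IsLocalization.coeSubmodule_fg K (IsFractionRing.injective D K) H).1 hHfg

theorem HasFiniteCharacter.exists_isMaxStarIdealOp (hfc : s.HasFiniteCharacter) {N : Ideal D}
    (hN : N ≠ ⊥) (hN1 : s.star (N : FractionalIdeal D⁰ K) ≠ 1) :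
    ∃ M, IsMaxStarIdealOp s.star M ∧ N ≤ M := by
  have hN' : (N : FractionalIdeal D⁰ K) ≠ 0 := coeIdeal_ne_zero.2 hN
  obtain ⟨J, hJ⟩ := le_one_iff_exists_coeIdeal.1 (s.star_le_one hN' coeIdeal_le_one)
  have hNJ : N ≤ J := by
    rw [← coeIdeal_le_coeIdeal K, hJ]
    exact s.le_star _ hN'
  have hJ0 : J ≠ ⊥ := fun h => hN (le_bot_iff.1 (h ▸ hNJ))
  set S : Set (Ideal D) := {L | L ≠ ⊥ ∧ L ≠ ⊤ ∧
    s.star (L : FractionalIdeal D⁰ K) = (L : FractionalIdeal D⁰ K)} with hS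
  have hJS : J ∈ S := by
    refine ⟨hJ0, ?_, by rw [hJ, s.star_star _ hN']⟩
    rintro rfl
    exact hN1 (by rw [← hJ, coeIdeal_top])
  have hub : ∀ c ⊆ S, IsChain (· ≤ ·) c → ∀ y ∈ c, ∃ ub ∈ S, ∀ z ∈ c, z ≤ ub := by
    intro c hc hchain y hy
    have hne : c.Nonempty := ⟨y, hy⟩
    have hyc : y ≤ sSup c := le_sSup hy
    have hc0 : sSup c ≠ ⊥ := fun h => (hc hy).1 (le_bot_iff.1 (h ▸ hyc))
    refine ⟨sSup c, ⟨hc0, ?_, le_antisymm ?_ (s.le_star _ (coeIdeal_ne_zero.2 hc0))⟩,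
      fun z hz => le_sSup hz⟩
    · intro htop
      obtain ⟨L, hL, h1L⟩ := (Submodule.mem_sSup_of_directed hne hchain.directedOn).1
        ((Ideal.eq_top_iff_one _).1 htop)
      exact (hc hL).2.1 ((Ideal.eq_top_iff_one L).2 h1L)
    · intro x hx
      obtain ⟨H, hH0, hHfg, hHc, hxH⟩ := hfc.exists_fg hc0 hx
      obtain ⟨L, hL, hHL⟩ :=
        (CompleteLattice.isCompactElement_iff_le_of_directed_sSup_le (Ideal D) H).1
        ((Submodule.fg_iff_compact H).1 hHfg) c hne hchain.directedOn hHc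
      have hxL := s.star_mono _ _ (coeIdeal_ne_zero.2 hH0) (coeIdeal_ne_zero.2 (hc hL).1)
        ((coeIdeal_le_coeIdeal K).2 hHL) hxH
      rw [(hc hL).2.2] at hxL
      exact (coeIdeal_le_coeIdeal K).2 (le_sSup hL) hxL
  obtain ⟨M, hJM, hM⟩ := zorn_le_nonempty₀ S hub J hJS
  refine ⟨M, ⟨hM.prop.1, hM.prop.2.1, hM.prop.2.2, fun L hL hLs hML => ?_⟩, hNJ.trans hJM⟩
  have hL0 : L ≠ ⊥ := fun h => hM.prop.1 (le_bot_iff.1 (h ▸ hML))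
  exact (hM.eq_of_le ⟨hL0, hL, hLs⟩ hML).symm

end StarOperation

end StarOperations

/-- If the localization of `D` at `M` is a valuation ring, a nonzero finitely generated ideal of
`D` is locally generated by one of its elements. -/
theorem Ideal.FG.exists_notMem_forall_dvd {D : Type*} [CommRing D] [IsDomain D] {M : Ideal D}
    [M.IsPrime] [ValuationRing (Localization.AtPrime M)] {I : Ideal D} (hI : I ≠ ⊥)
    (hfg : I.FG) : ∃ a ∈ I, a ≠ 0 ∧ ∃ t ∉ M, ∀ x ∈ I, a ∣ t * x := by
  set R := Localization.AtPrime M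
  have hinj : Function.Injective (algebraMap D R) :=
    IsLocalization.injective R M.primeCompl_le_nonZeroDivisors
  have hdvd : ∀ a b : D, algebraMap D R a ∣ algebraMap D R b → ∃ t ∉ M, a ∣ t * b := by
    rintro a b ⟨c, hc⟩
    obtain ⟨d, t, rfl⟩ := IsLocalization.exists_mk'_eq M.primeCompl c
    refine ⟨t, t.2, d, hinj ?_⟩
    rw [map_mul, map_mul, hc, mul_left_comm, IsLocalization.mk'_spec']
  obtain ⟨F, rfl⟩ := hfg
  suffices h : ∀ F : Finset D, ∃ a ∈ Ideal.span (F : Set D), ∃ t ∉ M, ∀ x ∈ F, a ∣ t * x by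
    obtain ⟨a, haI, t, htM, ht⟩ := h F
    have hall : ∀ x ∈ Ideal.span (F : Set D), a ∣ t * x := by
      intro x hx
      induction hx using Submodule.span_induction with
      | mem x hx => exact ht x hx
      | zero => simp
      | add x y _ _ hx hy => rw [mul_add]; exact dvd_add hx hy
      | smul r x _ hx => rw [smul_eq_mul, mul_left_comm]; exact hx.mul_left r
    refine ⟨a, haI, ?_, t, htM, hall⟩
    rintro rfl
    obtain ⟨x, hx, hx0⟩ := Submodule.exists_mem_ne_zero_of_ne_bot hI
    have ht0 : t ≠ 0 := fun h => htM (h ▸ M.zero_mem)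
    exact mul_ne_zero ht0 hx0 (zero_dvd_iff.1 (hall x hx))
  classical
  intro F
  induction F using Finset.induction_on with
  | empty =>
    exact ⟨0, Submodule.zero_mem _, 1, Ideal.one_notMem M, by simp⟩
  | insert b F hb ih =>
    obtain ⟨a, haF, t, htM, ht⟩ := ih
    have hFle : Ideal.span (F : Set D) ≤ Ideal.span (insert b F : Finset D) :=
      Ideal.span_mono (by simp)
    rcases ValuationRing.dvd_total (algebraMap D R a) (algebraMap D R b) with h | h
    · obtain ⟨u, huM, hu⟩ := hdvd _ _ h
      refine ⟨a, hFle haF, u * t, fun h => ?_, fun x hx => ?_⟩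
      · exact (Ideal.IsPrime.mem_or_mem ‹_› h).elim huM htM
      · rcases Finset.mem_insert.1 hx with rfl | hx
        · rw [mul_right_comm]; exact hu.mul_right t
        · rw [mul_assoc]; exact (ht x hx).mul_left u
    · obtain ⟨u, huM, hu⟩ := hdvd _ _ h
      refine ⟨b, Ideal.subset_span (by simp), u * t, fun h => ?_, fun x hx => ?_⟩
      · exact (Ideal.IsPrime.mem_or_mem ‹_› h).elim huM htM
      · rcases Finset.mem_insert.1 hx with rfl | hx
        · exact Dvd.intro_left _ rfl
        · rw [mul_assoc]; exact hu.trans (mul_dvd_mul_left u (ht x hx))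

section StarOperations

open FractionalIdeal

variable {D K : Type*} [CommRing D] [IsDomain D] [Field K] [Algebra D K] [IsFractionRing D K]
  {s : StarOperation D K}

namespace StarOperation

theorem IsSharp.star_mul_inv_eq_one (hsharp : s.IsSharp) (hst : s.IsStable)
    (hfc : s.HasFiniteCharacter) {I : Ideal D} (hI : I ≠ ⊥) (hfg : I.FG) :
    s.star ((I : FractionalIdeal D⁰ K) * (I : FractionalIdeal D⁰ K)⁻¹) = 1 := by
  have hI' : (I : FractionalIdeal D⁰ K) ≠ 0 := coeIdeal_ne_zero.2 hI
  obtain ⟨N, hN⟩ := le_one_iff_exists_coeIdeal.1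
    (mul_one_div_le_one (I := (I : FractionalIdeal D⁰ K)))
  rw [← inv_eq] at hN
  by_contra h1
  have hN0 : N ≠ ⊥ := by
    obtain ⟨b, hb, hb0⟩ := Submodule.exists_mem_ne_zero_of_ne_bot hI
    refine (Submodule.ne_bot_iff N).2 ⟨b, ?_, hb0⟩
    have h1 : (1 : K) ∈ (I : FractionalIdeal D⁰ K)⁻¹ := by
      rw [mem_inv_iff hI']
      intro y hy
      rw [one_mul]
      exact coeIdeal_le_one hy
    have := mul_mem_mul (mem_coeIdeal_of_mem D⁰ hb) h1
    rw [← hN, mul_one, mem_coeIdeal] at this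
    obtain ⟨b', hb', h⟩ := this
    exact IsFractionRing.injective D K h ▸ hb'
  rw [← hN] at h1
  obtain ⟨M, hM, hNM⟩ := hfc.exists_isMaxStarIdealOp hN0 h1
  have hMp := isPrime_of_isMaxStarIdealOp hM
  have := (hsharp.isSharpRing_localization hst hM).valuationRing
  obtain ⟨a, haI, ha0, t, htM, ht⟩ := hfg.exists_notMem_forall_dvd (M := M) hI
  have haK : algebraMap D K a ≠ 0 := by simpa using ha0
  have hinv : algebraMap D K t / algebraMap D K a ∈ (I : FractionalIdeal D⁰ K)⁻¹ := by
    rw [mem_inv_iff hI']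
    intro y hy
    obtain ⟨x, hx, rfl⟩ := (mem_coeIdeal _).1 hy
    obtain ⟨d, hd⟩ := ht x hx
    refine (mem_one_iff _).2 ⟨d, ?_⟩
    rw [div_mul_eq_mul_div, eq_div_iff haK, ← map_mul, ← map_mul, hd, mul_comm]
  have hmem := mul_mem_mul (mem_coeIdeal_of_mem D⁰ haI) hinv
  rw [mul_div_cancel₀ _ haK, ← hN, mem_coeIdeal] at hmem
  obtain ⟨t', ht', h⟩ := hmem
  exact htM (hNM (IsFractionRing.injective D K h ▸ ht'))

theorem IsSharp.not_lt_of_isPrime (hsharp : s.IsSharp) (hst : s.IsStable)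
    (hfc : s.HasFiniteCharacter) {P Q : Ideal D} (hP : P ≠ ⊥) (hPp : P.IsPrime)
    (hQp : Q.IsPrime) (hQ : s.star (Q : FractionalIdeal D⁰ K) = (Q : FractionalIdeal D⁰ K)) :
    ¬ P < Q := by
  intro hPQ
  have hQ0 : Q ≠ ⊥ := fun h => hP (le_bot_iff.1 (h ▸ hPQ.le))
  obtain ⟨M, hM, hQM⟩ := hfc.exists_isMaxStarIdealOp hQ0 (by
    rw [hQ, ← coeIdeal_top, Ne, coeIdeal_inj]
    exact hQp.ne_top)
  have hMp := isPrime_of_isMaxStarIdealOp hM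
  have hR := hsharp.isSharpRing_localization hst hM
  have := hR.valuationRing
  have hinj : Function.Injective (algebraMap D (Localization.AtPrime M)) :=
    IsLocalization.injective _ M.primeCompl_le_nonZeroDivisors
  obtain ⟨q, hqQ, hqP⟩ := SetLike.exists_of_lt hPQ
  obtain ⟨p, hpP, hp0⟩ := Submodule.exists_mem_ne_zero_of_ne_bot hP
  have hq : ¬ IsUnit (algebraMap D (Localization.AtPrime M) q) := by
    rw [IsLocalization.AtPrime.isUnit_to_map_iff (Localization.AtPrime M) M]
    exact fun h => h (hQM hqQ)
  obtain ⟨n, c, hc⟩ := hR.hasIdealGCD.exists_dvd_pow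
    (p := algebraMap D (Localization.AtPrime M) p) (by simpa using hinj.ne hp0) hq
  obtain ⟨d, t, rfl⟩ := IsLocalization.exists_mk'_eq M.primeCompl c
  have heq : (t : D) * q ^ n = p * d := by
    apply hinj
    rw [map_mul, map_mul, map_pow, hc, mul_left_comm, IsLocalization.mk'_spec']
  have hmem : (t : D) * q ^ n ∈ P := heq ▸ P.mul_mem_right d hpP
  rcases hPp.mem_or_mem hmem with h | h
  · exact t.2 (hQM (hPQ.le h))
  · exact hqP (hPp.mem_of_pow_mem n h)

end StarOperation

end StarOperations

/-- Let `*` be a stable star operation of finite character on `D`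
such that `D` is `*`-sharp. Then `D_M` is a valuation domain with value group a
complete subgroup of the reals for every maximal `*`-ideal `M`; in particular `D` is
a P`*`MD (every nonzero finitely generated ideal is `*`-invertible) of
`*`-dimension at most `1`. -/
theorem statement2 (D : Type*) [CommRing D] [IsDomain D]
    (K : Type*) [Field K] [Algebra D K] [IsFractionRing D K]
    (s : StarOperation D K) (hst : s.IsStable) (hfc : s.HasFiniteCharacter)
    (hsharp : s.IsSharp) :
    (∀ M : Ideal D, IsMaxStarIdealOp s.star M → ∃ _ : M.IsPrime,
      ∃ _ : IsDomain (Localization.AtPrime M),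
        IsCompleteValuationDomain (Localization.AtPrime M)) ∧
    (∀ I : Ideal D, I ≠ 0 → I.FG →
      s.star ((I : FractionalIdeal D⁰ K) * (I : FractionalIdeal D⁰ K)⁻¹) = 1) ∧
    (∀ P Q : Ideal D, P ≠ 0 → P.IsPrime →
      s.star (P : FractionalIdeal D⁰ K) = (P : FractionalIdeal D⁰ K) → Q.IsPrime →
      s.star (Q : FractionalIdeal D⁰ K) = (Q : FractionalIdeal D⁰ K) → ¬ P < Q) := by
  refine ⟨fun M hM => ?_, fun I hI hfg => hsharp.star_mul_inv_eq_one hst hfc hI hfg,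
    fun P Q hP hPp _ hQp hQ => hsharp.not_lt_of_isPrime hst hfc hP hPp hQp hQ⟩
  have hMp := StarOperation.isPrime_of_isMaxStarIdealOp hM
  exact ⟨hMp, inferInstance, (hsharp.isSharpRing_localization hst hM).isCompleteValuationDomain⟩
end

section
/- Let D be an integral domain and * a stable star operation on D such that D is *-sharp. If I and J are nonzero ideals of D such that (I + J)_v = D, then (I_v + J_v)* = D. -/
open scoped nonZeroDivisors

section StarSharpDefs

variable {D K : Type*} [CommRing D] [IsDomain D] [Field K] [Algebra D K] [IsFractionRing D K]

lemma inv_ne_zero' {I : FractionalIdeal D⁰ K} (hI : I ≠ 0) : I⁻¹ ≠ 0 := by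
  obtain ⟨d, hd, hdI⟩ := I.isFractional
  have hmem : algebraMap D K d ∈ I⁻¹ := by
    rw [FractionalIdeal.mem_inv_iff hI]
    intro y hy
    obtain ⟨c, hc⟩ := hdI y hy
    refine ⟨c, trivial, ?_⟩
    simpa [Algebra.smul_def] using hc
  intro h0
  rw [h0] at hmem
  have : algebraMap D K d ≠ 0 :=
    IsFractionRing.to_map_ne_zero_of_mem_nonZeroDivisors hd
  exact this (by simpa using hmem)

/-- The `v`-operation `I ↦ I_v = (I⁻¹)⁻¹`. -/
noncomputable def vOp (I : FractionalIdeal D⁰ K) : FractionalIdeal D⁰ K := (I⁻¹)⁻¹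

lemma vOp_mono {I J : FractionalIdeal D⁰ K} (h : I ≤ J) : vOp I ≤ vOp J := by
  rcases eq_or_ne I 0 with rfl | hI
  · show ((0 : FractionalIdeal D⁰ K)⁻¹)⁻¹ ≤ vOp J
    rw [FractionalIdeal.inv_zero', FractionalIdeal.inv_zero']
    exact FractionalIdeal.zero_le _
  have hJ : J ≠ 0 := fun hJ0 => hI (le_antisymm (hJ0 ▸ h) (FractionalIdeal.zero_le I))
  exact FractionalIdeal.inv_anti_mono (inv_ne_zero' hJ) (inv_ne_zero' hI)
    (FractionalIdeal.inv_anti_mono hI hJ h)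

end StarSharpDefs

section StarSharpLemmas

variable {D K : Type*} [CommRing D]

lemma ideal_add_mul_add_le (U V : Ideal D) : (U + V) * (U + V) ≤ U * U + V := by
  rw [add_mul, mul_add, add_assoc]
  exact sup_le_sup_left (sup_le Ideal.mul_le_right Ideal.mul_le_left) _

variable [Field K] [Algebra D K]

lemma fractionalIdeal_mul_ne_zero {X Y : FractionalIdeal D⁰ K} (hX : X ≠ 0) (hY : Y ≠ 0) :
    X * Y ≠ 0 := by
  contrapose! hX
  rw [FractionalIdeal.eq_zero_iff]
  intro x hx
  by_contra hx0
  refine hY (FractionalIdeal.eq_zero_iff.2 fun y hy => ?_)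
  have hxy := FractionalIdeal.mul_mem_mul hx hy
  rw [hX, FractionalIdeal.mem_zero_iff] at hxy
  exact (mul_eq_zero.1 hxy).resolve_left hx0

lemma fractionalIdeal_ne_zero_of_le {X Y : FractionalIdeal D⁰ K} (hX : X ≠ 0) (h : X ≤ Y) :
    Y ≠ 0 := by
  rintro rfl
  exact hX (le_antisymm h (FractionalIdeal.zero_le X))

variable [IsDomain D] [IsFractionRing D K]

lemma le_inv_iff_mul_le_one {X Y : FractionalIdeal D⁰ K} (hY : Y ≠ 0) :
    X ≤ Y⁻¹ ↔ X * Y ≤ 1 := by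
  rw [FractionalIdeal.inv_eq, FractionalIdeal.le_div_iff_mul_le hY]

lemma fractionalIdeal_inv_mul_le_one {X : FractionalIdeal D⁰ K} (hX : X ≠ 0) : X⁻¹ * X ≤ 1 :=
  (le_inv_iff_mul_le_one hX).1 le_rfl

lemma le_vOp {X : FractionalIdeal D⁰ K} (hX : X ≠ 0) : X ≤ vOp X := by
  rw [vOp, le_inv_iff_mul_le_one (inv_ne_zero' hX), mul_comm]
  exact fractionalIdeal_inv_mul_le_one hX

lemma vOp_ne_zero {X : FractionalIdeal D⁰ K} (hX : X ≠ 0) : vOp X ≠ 0 :=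
  inv_ne_zero' (inv_ne_zero' hX)

lemma inv_le_one_of_vOp_eq_one {X : FractionalIdeal D⁰ K} (hX : X ≠ 0) (h : vOp X = 1) :
    X⁻¹ ≤ 1 := by
  have := (le_inv_iff_mul_le_one (X := 1) (inv_ne_zero' hX)).1 h.ge
  rwa [one_mul] at this

/-- If `A + B_v` has trivial inverse, then `(B_v : A) ∩ D ⊆ B_v`. -/
lemma le_vOp_of_mul_le {X A B : FractionalIdeal D⁰ K} (hB : B ≠ 0)
    (hAB : (A + vOp B)⁻¹ ≤ 1) (hX : X ≤ 1) (hXA : X * A ≤ vOp B) : X ≤ vOp B := by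
  have hX' : X * (A + vOp B) ≤ vOp B := by
    rw [mul_add, ← FractionalIdeal.sup_eq_add]
    exact sup_le hXA (mul_le_of_le_one_left' hX)
  have hne : A + vOp B ≠ 0 :=
    fractionalIdeal_ne_zero_of_le (vOp_ne_zero hB) (by
      rw [← FractionalIdeal.sup_eq_add]; exact le_sup_right)
  rw [vOp, le_inv_iff_mul_le_one (inv_ne_zero' hB)]
  refine le_trans ((le_inv_iff_mul_le_one hne).2 ?_) hAB
  calc X * B⁻¹ * (A + vOp B) = X * (A + vOp B) * B⁻¹ := by ring
    _ ≤ vOp B * B⁻¹ := by gcongr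
    _ ≤ 1 := fractionalIdeal_inv_mul_le_one (inv_ne_zero' hB)

namespace StarOperation

variable (s : StarOperation D K)

lemma star_le_star {X Y : FractionalIdeal D⁰ K} (hX : X ≠ 0) (hY : Y ≠ 0) (h : X ≤ s.star Y) :
    s.star X ≤ s.star Y := by
  rw [← s.star_star Y hY]
  exact s.star_mono _ _ hX (fractionalIdeal_ne_zero_of_le hX h) h

lemma mul_star_le {X Y : FractionalIdeal D⁰ K} (hX : X ≠ 0) (hY : Y ≠ 0) :
    X * s.star Y ≤ s.star (X * Y) := by
  rw [FractionalIdeal.mul_le]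
  intro a ha y hy
  rcases eq_or_ne a 0 with rfl | ha0
  · rw [zero_mul]; exact FractionalIdeal.zero_mem _
  have ha' : FractionalIdeal.spanSingleton D⁰ a ≠ 0 :=
    FractionalIdeal.spanSingleton_ne_zero_iff.2 ha0
  have h : FractionalIdeal.spanSingleton D⁰ a * s.star Y ≤ s.star (X * Y) := by
    rw [← s.star_smul a ha0 Y hY]
    refine s.star_mono _ _ (fractionalIdeal_mul_ne_zero ha' hY)
      (fractionalIdeal_mul_ne_zero hX hY) ?_
    gcongr
    exact FractionalIdeal.spanSingleton_le_iff_mem.2 ha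
  exact h (FractionalIdeal.mul_mem_mul (FractionalIdeal.mem_spanSingleton_self D⁰ a) hy)

/-- In a `*`-sharp domain every divisorial ideal is `*`-invertible. -/
lemma IsSharp.one_le_star_vOp_mul_inv {s : StarOperation D K} (hs : s.IsSharp) {I : Ideal D}
    (hI : I ≠ 0) :
    1 ≤ s.star (vOp (I : FractionalIdeal D⁰ K) * (I : FractionalIdeal D⁰ K)⁻¹) := by
  have hI' : (I : FractionalIdeal D⁰ K) ≠ 0 := FractionalIdeal.coeIdeal_ne_zero.2 hI
  have hIi := inv_ne_zero' hI'
  obtain ⟨x, hxI, hx⟩ := Submodule.exists_mem_ne_zero_of_ne_bot hI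
  have hxK : algebraMap D K x ≠ 0 := by simpa using hx
  set P : FractionalIdeal D⁰ K := FractionalIdeal.spanSingleton D⁰ (algebraMap D K x) with hP
  set Q : FractionalIdeal D⁰ K := FractionalIdeal.spanSingleton D⁰ (algebraMap D K x)⁻¹ with hQ
  have hPQ : P * Q = 1 := by
    rw [hP, hQ, FractionalIdeal.spanSingleton_mul_spanSingleton, mul_inv_cancel₀ hxK,
      FractionalIdeal.spanSingleton_one]
  have hP0 : P ≠ 0 := left_ne_zero_of_mul_eq_one hPQ
  have hQ0 : Q ≠ 0 := right_ne_zero_of_mul_eq_one hPQ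
  have hspan : ((Ideal.span {x} : Ideal D) : FractionalIdeal D⁰ K) = P :=
    FractionalIdeal.coeIdeal_span_singleton x
  have hPI : P ≤ I := by
    rw [hP, FractionalIdeal.spanSingleton_le_iff_mem]
    exact FractionalIdeal.mem_coeIdeal_of_mem D⁰ hxI
  have hEle : P * (I : FractionalIdeal D⁰ K)⁻¹ ≤ 1 :=
    le_trans (mul_le_mul_left hPI _) (by rw [mul_comm]; exact fractionalIdeal_inv_mul_le_one hI')
  obtain ⟨E, hE⟩ := FractionalIdeal.le_one_iff_exists_coeIdeal.1 hEle
  have hE0 : E ≠ 0 := by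
    refine (FractionalIdeal.coeIdeal_ne_zero (K := K)).1 ?_
    rw [hE]
    exact fractionalIdeal_mul_ne_zero hP0 hIi
  have hstarP : s.star P = P := by
    have := s.star_smul _ hxK 1 one_ne_zero
    rwa [s.star_one, mul_one] at this
  obtain ⟨H, L, hH, hL, hHL, hIH, hEL⟩ := hs (Ideal.span {x}) I E
    (by simpa using hx) hI hE0 (by
      rw [← FractionalIdeal.coeIdeal_le_coeIdeal K, FractionalIdeal.coeIdeal_mul, hE, hspan]
      calc (I : FractionalIdeal D⁰ K) * (P * (I : FractionalIdeal D⁰ K)⁻¹)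
          = P * ((I : FractionalIdeal D⁰ K)⁻¹ * I) := by ring
        _ ≤ P * 1 := by gcongr; exact fractionalIdeal_inv_mul_le_one hI'
        _ = P := mul_one P)
  rw [hspan, hstarP] at hHL
  rw [hE] at hEL
  have hH' : (H : FractionalIdeal D⁰ K) ≠ 0 := FractionalIdeal.coeIdeal_ne_zero.2 hH
  have hL' : (L : FractionalIdeal D⁰ K) ≠ 0 := FractionalIdeal.coeIdeal_ne_zero.2 hL
  have key1 : (H : FractionalIdeal D⁰ K) * s.star L ≤ P := by
    rw [hHL]; exact s.mul_star_le hH' hL'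
  have key2 : (L : FractionalIdeal D⁰ K) * s.star H ≤ P := by
    rw [hHL, mul_comm (H : FractionalIdeal D⁰ K)]; exact s.mul_star_le hL' hH'
  have cancel : ∀ {Y : FractionalIdeal D⁰ K}, Y ≤ P → Q * Y ≤ 1 := fun {Y} h =>
    (mul_le_mul_right h Q).trans_eq (by rw [mul_comm, hPQ])
  have hHv : (H : FractionalIdeal D⁰ K) ≤ vOp (I : FractionalIdeal D⁰ K) := by
    rw [vOp, le_inv_iff_mul_le_one hIi]
    refine le_trans ?_ (cancel key1)
    calc (H : FractionalIdeal D⁰ K) * (I : FractionalIdeal D⁰ K)⁻¹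
        = Q * (H * (P * (I : FractionalIdeal D⁰ K)⁻¹)) := by
          rw [mul_left_comm (H : FractionalIdeal D⁰ K), ← mul_assoc Q, mul_comm Q, hPQ, one_mul]
      _ ≤ Q * (H * s.star L) := by gcongr
  have hLI : Q * L ≤ (I : FractionalIdeal D⁰ K)⁻¹ := by
    rw [le_inv_iff_mul_le_one hI']
    refine le_trans ?_ (cancel key2)
    rw [mul_assoc]
    gcongr
  have h1 : s.star (Q * (H * L)) = 1 := by
    rw [hQ, s.star_smul _ (inv_ne_zero hxK) _ (fractionalIdeal_mul_ne_zero hH' hL'), ← hHL, ← hQ,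
      mul_comm, hPQ]
  rw [← h1]
  refine s.star_mono _ _ (fractionalIdeal_mul_ne_zero hQ0 (fractionalIdeal_mul_ne_zero hH' hL'))
    (fractionalIdeal_mul_ne_zero (vOp_ne_zero hI') hIi) ?_
  calc Q * ((H : FractionalIdeal D⁰ K) * L) = H * (Q * L) := mul_left_comm _ _ _
    _ ≤ _ := mul_le_mul' hHv hLI

/-- Cancellation of a `*`-invertible ideal `A` relatively prime to `B`. -/
lemma IsStable.le_star_add {s : StarOperation D K} (hst : s.IsStable)
    {A A' B X : FractionalIdeal D⁰ K} (hA : A ≠ 0) (hA' : A' ≠ 0) (hB : B ≠ 0) (hX0 : X ≠ 0)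
    (hA1 : A ≤ 1) (hAA' : A * A' ≤ 1) (hinv : 1 ≤ s.star (A * A'))
    (hcolon : ∀ Y : FractionalIdeal D⁰ K, Y ≤ 1 → Y * A ≤ B → Y ≤ B)
    (hX : X ≤ 1) (h : X * A ≤ s.star (A * A + B)) : X ≤ s.star (A + B) := by
  have hAB : A * A + B ≠ 0 :=
    fractionalIdeal_ne_zero_of_le hB (by rw [← FractionalIdeal.sup_eq_add]; exact le_sup_right)
  have hC : A + A' * B ≠ 0 :=
    fractionalIdeal_ne_zero_of_le hA (by rw [← FractionalIdeal.sup_eq_add]; exact le_sup_left)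
  have h1 : X * (A * A') ≤ s.star (A + A' * B) := by
    calc X * (A * A') = A' * (X * A) := by ring
      _ ≤ A' * s.star (A * A + B) := by gcongr
      _ ≤ s.star (A' * (A * A + B)) := s.mul_star_le hA' hAB
      _ ≤ s.star (A + A' * B) := by
        refine s.star_mono _ _ (fractionalIdeal_mul_ne_zero hA' hAB) hC ?_
        calc A' * (A * A + B) = A * (A * A') + A' * B := by ring
          _ ≤ A * 1 + A' * B := by
            rw [← FractionalIdeal.sup_eq_add, ← FractionalIdeal.sup_eq_add]
            exact sup_le_sup_right (mul_le_mul_right hAA' A) _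
          _ = A + A' * B := by rw [mul_one]
  have h2 : X ≤ s.star (A + A' * B) := by
    calc X = X * 1 := (mul_one X).symm
      _ ≤ X * s.star (A * A') := by gcongr
      _ ≤ s.star (X * (A * A')) := s.mul_star_le hX0 (fractionalIdeal_mul_ne_zero hA hA')
      _ ≤ s.star (A + A' * B) := s.star_le_star
          (fractionalIdeal_mul_ne_zero hX0 (fractionalIdeal_mul_ne_zero hA hA')) hC h1
  have hAB' : A + B ≠ 0 :=
    fractionalIdeal_ne_zero_of_le hB (by rw [← FractionalIdeal.sup_eq_add]; exact le_sup_right)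
  have h3 : (A + A' * B) ⊓ 1 ≤ A + B := by
    intro y hy
    obtain ⟨hy1, hy2⟩ := hy
    obtain ⟨a, ha, b, hb, rfl⟩ := (FractionalIdeal.mem_add _ _ _).1 hy1
    refine (FractionalIdeal.mem_add _ _ _).2 ⟨a, ha, b, ?_, rfl⟩
    have hb1 : b ∈ (1 : FractionalIdeal D⁰ K) := by
      have := Submodule.sub_mem _ hy2 (hA1 ha)
      rwa [add_sub_cancel_left] at this
    rw [← FractionalIdeal.spanSingleton_le_iff_mem]
    refine hcolon _ (FractionalIdeal.spanSingleton_le_iff_mem.2 hb1) ?_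
    calc FractionalIdeal.spanSingleton D⁰ b * A ≤ A' * B * A := by
          gcongr; exact FractionalIdeal.spanSingleton_le_iff_mem.2 hb
      _ = A * A' * B := by ring
      _ ≤ B := mul_le_of_le_one_left' hAA'
  have h4 : A ≤ (A + A' * B) ⊓ 1 :=
    le_inf (by rw [← FractionalIdeal.sup_eq_add]; exact le_sup_left) hA1
  calc X ≤ s.star (A + A' * B) ⊓ s.star 1 := le_inf h2 (by rwa [s.star_one])
    _ = s.star ((A + A' * B) ⊓ 1) := (hst _ _ hC one_ne_zero).symm
    _ ≤ s.star (A + B) := s.star_mono _ _ (fractionalIdeal_ne_zero_of_le hA h4) hAB' h3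

end StarOperation

end StarSharpLemmas

/-- Let `*` be a stable star operation on `D` such that `D` is
`*`-sharp. If `I, J` are nonzero ideals of `D` with `(I + J)_v = D`, then
`(I_v + J_v)* = D`. -/
theorem statement7 (D : Type*) [CommRing D] [IsDomain D]
    (K : Type*) [Field K] [Algebra D K] [IsFractionRing D K]
    (s : StarOperation D K) (hst : s.IsStable) (hsharp : s.IsSharp)
    (I J : Ideal D) (hI : I ≠ 0) (hJ : J ≠ 0)
    (hv : vOp ((I : FractionalIdeal D⁰ K) + (J : FractionalIdeal D⁰ K)) = 1) :
    s.star (vOp (I : FractionalIdeal D⁰ K) + vOp (J : FractionalIdeal D⁰ K)) = 1 := by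
  have hI' : (I : FractionalIdeal D⁰ K) ≠ 0 := FractionalIdeal.coeIdeal_ne_zero.2 hI
  have hJ' : (J : FractionalIdeal D⁰ K) ≠ 0 := FractionalIdeal.coeIdeal_ne_zero.2 hJ
  have hinvI := hsharp.one_le_star_vOp_mul_inv hI
  have hinvJ := hsharp.one_le_star_vOp_mul_inv hJ
  have hcI := fun X => le_vOp_of_mul_le (X := X) (A := vOp (J : FractionalIdeal D⁰ K)) hI'
  have hcJ := fun X => le_vOp_of_mul_le (X := X) (A := vOp (I : FractionalIdeal D⁰ K)) hJ'
  have hAi : vOp (I : FractionalIdeal D⁰ K) * (I : FractionalIdeal D⁰ K)⁻¹ ≤ 1 :=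
    fractionalIdeal_inv_mul_le_one (inv_ne_zero' hI')
  have hBi : vOp (J : FractionalIdeal D⁰ K) * (J : FractionalIdeal D⁰ K)⁻¹ ≤ 1 :=
    fractionalIdeal_inv_mul_le_one (inv_ne_zero' hJ')
  have hIJ : (I : FractionalIdeal D⁰ K) + J ≠ 0 := fractionalIdeal_ne_zero_of_le hI' (by
    rw [← FractionalIdeal.sup_eq_add]; exact le_sup_left)
  have hA1 : vOp (I : FractionalIdeal D⁰ K) ≤ 1 := by
    rw [← hv]
    exact vOp_mono (by rw [← FractionalIdeal.sup_eq_add]; exact le_sup_left)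
  have hB1 : vOp (J : FractionalIdeal D⁰ K) ≤ 1 := by
    rw [← hv]
    exact vOp_mono (by rw [← FractionalIdeal.sup_eq_add]; exact le_sup_right)
  have hABinv :
      (vOp (I : FractionalIdeal D⁰ K) + vOp (J : FractionalIdeal D⁰ K))⁻¹ ≤ 1 := by
    have hle : (I : FractionalIdeal D⁰ K) + J ≤
        vOp (I : FractionalIdeal D⁰ K) + vOp (J : FractionalIdeal D⁰ K) := by
      rw [← FractionalIdeal.sup_eq_add, ← FractionalIdeal.sup_eq_add]
      exact sup_le_sup (le_vOp hI') (le_vOp hJ')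
    exact (FractionalIdeal.inv_anti_mono hIJ (fractionalIdeal_ne_zero_of_le hIJ hle) hle).trans
      (inv_le_one_of_vOp_eq_one hIJ hv)
  have hA0 := vOp_ne_zero hI'
  have hB0 := vOp_ne_zero hJ'
  have hIi := inv_ne_zero' hI'
  have hJi := inv_ne_zero' hJ'
  replace hcI := fun X => hcI X (by rwa [add_comm])
  replace hcJ := fun X => hcJ X hABinv
  generalize vOp (I : FractionalIdeal D⁰ K) = A at *
  generalize vOp (J : FractionalIdeal D⁰ K) = B at *
  have hAB0 : A + B ≠ 0 := fractionalIdeal_ne_zero_of_le hA0 (by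
    rw [← FractionalIdeal.sup_eq_add]; exact le_sup_left)
  have hAB1 : A + B ≤ 1 := by rw [← FractionalIdeal.sup_eq_add]; exact sup_le hA1 hB1
  obtain ⟨U, rfl⟩ := FractionalIdeal.le_one_iff_exists_coeIdeal.1 hA1
  obtain ⟨V, rfl⟩ := FractionalIdeal.le_one_iff_exists_coeIdeal.1 hB1
  have hUV : U + V ≠ 0 := by
    refine (FractionalIdeal.coeIdeal_ne_zero (K := K)).1 ?_
    rw [Submodule.add_eq_sup, FractionalIdeal.coeIdeal_sup]
    exact hAB0
  have hW : U * U + V ≠ 0 := by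
    intro h
    exact FractionalIdeal.coeIdeal_ne_zero.1 hB0 (add_eq_zero.1 h).2
  obtain ⟨H, L, hH, hL, hHL, hUH, hUL⟩ := hsharp (U * U + V) (U + V) (U + V) hW hUV hUV
    (ideal_add_mul_add_le U V)
  have coe_add : ∀ S T : Ideal D,
      ((S + T : Ideal D) : FractionalIdeal D⁰ K) = S + T := fun S T =>
    FractionalIdeal.coeIdeal_sup S T
  rw [coe_add, FractionalIdeal.coeIdeal_mul] at hHL
  rw [coe_add] at hUH hUL
  have hH' : (H : FractionalIdeal D⁰ K) ≠ 0 := FractionalIdeal.coeIdeal_ne_zero.2 hH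
  have hL' : (L : FractionalIdeal D⁰ K) ≠ 0 := FractionalIdeal.coeIdeal_ne_zero.2 hL
  have hUle : (U : FractionalIdeal D⁰ K) ≤ U + V := by
    rw [← FractionalIdeal.sup_eq_add]; exact le_sup_left
  have hHle : (H : FractionalIdeal D⁰ K) ≤ s.star (U + V) := by
    refine hst.le_star_add hA0 hIi hB0 hH' hA1 hAi hinvI hcJ FractionalIdeal.coeIdeal_le_one ?_
    rw [hHL]
    exact (mul_le_mul_right (hUle.trans hUL) _).trans (s.mul_star_le hH' hL')
  have hLle : (L : FractionalIdeal D⁰ K) ≤ s.star (U + V) := by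
    refine hst.le_star_add hA0 hIi hB0 hL' hA1 hAi hinvI hcJ FractionalIdeal.coeIdeal_le_one ?_
    rw [hHL, mul_comm (H : FractionalIdeal D⁰ K)]
    exact (mul_le_mul_right (hUle.trans hUH) _).trans (s.mul_star_le hL' hH')
  have hVU0 : (V : FractionalIdeal D⁰ K) * V + U ≠ 0 := fractionalIdeal_ne_zero_of_le hA0 (by
    rw [← FractionalIdeal.sup_eq_add]; exact le_sup_right)
  have hsq : ((U : FractionalIdeal D⁰ K) + V) * (U + V) ≤ V * V + U := by
    calc ((U : FractionalIdeal D⁰ K) + V) * (U + V) = V * V + (U + (V + V)) * U := by ring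
      _ ≤ V * V + U := by
        rw [← FractionalIdeal.sup_eq_add, ← FractionalIdeal.sup_eq_add,
          ← FractionalIdeal.sup_eq_add, ← FractionalIdeal.sup_eq_add]
        exact sup_le_sup_left (mul_le_of_le_one_left' (sup_le hA1 (sup_le hB1 hB1))) _
  have hHL' : (H : FractionalIdeal D⁰ K) * L ≤ s.star (V * V + U) := by
    calc (H : FractionalIdeal D⁰ K) * L ≤ H * s.star (U + V) := by gcongr
      _ ≤ s.star (H * (U + V)) := s.mul_star_le hH' hAB0
      _ ≤ s.star (V * V + U) := s.star_le_star (fractionalIdeal_mul_ne_zero hH' hAB0) hVU0 (by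
        calc (H : FractionalIdeal D⁰ K) * (U + V) ≤ s.star (U + V) * (U + V) := by gcongr
          _ = (U + V) * s.star (U + V) := mul_comm _ _
          _ ≤ s.star ((U + V) * (U + V)) := s.mul_star_le hAB0 hAB0
          _ ≤ s.star (V * V + U) := s.star_mono _ _ (fractionalIdeal_mul_ne_zero hAB0 hAB0) hVU0 hsq)
  have hUV0 : (U : FractionalIdeal D⁰ K) * U + V ≠ 0 := fractionalIdeal_ne_zero_of_le hB0 (by
    rw [← FractionalIdeal.sup_eq_add]; exact le_sup_right)
  have hVle : (V : FractionalIdeal D⁰ K) ≤ s.star (V * V + U) := by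
    calc (V : FractionalIdeal D⁰ K) ≤ U * U + V := by
          rw [← FractionalIdeal.sup_eq_add]; exact le_sup_right
      _ ≤ s.star (U * U + V) := s.le_star _ hUV0
      _ = s.star (H * L) := hHL
      _ ≤ s.star (V * V + U) := s.star_le_star (fractionalIdeal_mul_ne_zero hH' hL') hVU0 hHL'
  refine le_antisymm ?_ ?_
  · exact (s.star_mono _ _ hAB0 one_ne_zero hAB1).trans_eq s.star_one
  · rw [add_comm]
    exact hst.le_star_add hB0 hJi hA0 one_ne_zero hB1 hBi hinvJ hcI le_rfl (by rwa [one_mul])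
end
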